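/- There exist real numbers ν with 0 < ν < 1, C > 0 and D > 0 such that the growth function γ of the Grigorchuk group G with respect to the generating set {a, b, c, d} satisfies γ(n) ≤ C·exp(D·n^ν) for all n; in particular (ln γ(n))/n → 0 as n → ∞, so G has subexponential growth. -/

import Mathlib

namespace Grig

def aFun : List Bool → List Bool
  | [] => []
  | x :: v => (!x) :: v

mutual
  def bFun : List Bool → List Bool
    | [] => []
    | false :: v => false :: aFun v
    | true :: v => true :: cFun v
  def cFun : List Bool → List Bool
    | [] => []
    | false :: v => false :: aFun v
    | true :: v => true :: dFun v
  def dFun : List Bool → List Bool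
    | [] => []
    | false :: v => false :: v
    | true :: v => true :: bFun v
end

theorem aFun_invol : Function.Involutive aFun := by
  intro v; cases v <;> simp [aFun]

theorem bcd_invol : ∀ v, bFun (bFun v) = v ∧ cFun (cFun v) = v ∧ dFun (dFun v) = v := by
  intro v
  induction v with
  | nil => simp [bFun, cFun, dFun]
  | cons x v ih =>
    cases x <;> simp [bFun, cFun, dFun, aFun_invol v, ih.1, ih.2.1, ih.2.2]

/-- The automorphism `a` of the binary tree. -/
def a : Equiv.Perm (List Bool) := Function.Involutive.toPerm aFun aFun_invol

def b : Equiv.Perm (List Bool) := Function.Involutive.toPerm bFun (fun v => (bcd_invol v).1)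

def c : Equiv.Perm (List Bool) := Function.Involutive.toPerm cFun (fun v => (bcd_invol v).2.1)

def d : Equiv.Perm (List Bool) := Function.Involutive.toPerm dFun (fun v => (bcd_invol v).2.2)

/-- The Grigorchuk group, as the subgroup generated by `a, b, c, d` inside the
permutation group of the vertex set of the binary tree. -/
def grigG : Subgroup (Equiv.Perm (List Bool)) := Subgroup.closure {a, b, c, d}

end Grig

namespace Grig

/-- The growth function of the Grigorchuk group with respect to `{a, b, c, d}`: the number
of elements that are products of at most `n` elements of `{a, b, c, d}`. -/
noncomputable def grigGrowth (n : ℕ) : ℕ :=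
  Nat.card {g : Equiv.Perm (List Bool) |
    ∃ l : List (Equiv.Perm (List Bool)), l.length ≤ n ∧
      (∀ x ∈ l, x ∈ ({a, b, c, d} : Set (Equiv.Perm (List Bool)))) ∧ l.prod = g}

end Grig

namespace Grig

/-- Letters for words in the generators. -/
inductive Lt
  | a | b | c | d

instance : Finite Lt :=
  Set.finite_univ_iff.1 ((Set.toFinite ({.a, .b, .c, .d} : Set Lt)).subset
    (fun x _ => by cases x <;> simp))

/-- Action of a letter. -/
def act : Lt → List Bool → List Bool
  | .a => aFun
  | .b => bFun
  | .c => cFun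
  | .d => dFun

/-- Weight of a letter. -/
def wl : Lt → ℕ
  | .a => 3
  | .b => 3
  | .c => 2
  | .d => 1

def wt : List Lt → ℕ
  | [] => 0
  | x :: t => wl x + wt t

def ev : List Lt → List Bool → List Bool
  | [], v => v
  | x :: t, v => act x (ev t v)

theorem wt_append (s t : List Lt) : wt (s ++ t) = wt s + wt t := by
  induction s with
  | nil => simp [wt]
  | cons x s ih => simp [wt, ih]; omega

theorem ev_append (s t : List Lt) (v : List Bool) : ev (s ++ t) v = ev s (ev t v) := by
  induction s with
  | nil => simp [ev]
  | cons x s ih => simp [ev, ih]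

theorem act_act (x : Lt) (v : List Bool) : act x (act x v) = v := by
  cases x
  · exact aFun_invol v
  · exact (bcd_invol v).1
  · exact (bcd_invol v).2.1
  · exact (bcd_invol v).2.2

theorem bcd_mul : ∀ v, (bFun (cFun v) = dFun v ∧ cFun (bFun v) = dFun v) ∧
    (bFun (dFun v) = cFun v ∧ dFun (bFun v) = cFun v) ∧
    (cFun (dFun v) = bFun v ∧ dFun (cFun v) = bFun v) := by
  intro v
  induction v with
  | nil => simp [bFun, cFun, dFun]
  | cons x v ih =>
    obtain ⟨⟨h1, h2⟩, ⟨h3, h4⟩, h5, h6⟩ := ih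
    cases x <;> simp [bFun, cFun, dFun, aFun_invol v, h1, h2, h3, h4, h5, h6]

/-- Two distinct letters among `b, c, d` multiply to the third one. -/
theorem act_mul (x y : Lt) (hx : x ≠ .a) (hy : y ≠ .a) (hxy : x ≠ y) :
    ∃ z, z ≠ .a ∧ wl z ≤ wl x + wl y ∧ ∀ v, act x (act y v) = act z v := by
  cases x <;> cases y <;> first
    | exact absurd rfl hx
    | exact absurd rfl hy
    | exact absurd rfl hxy
    | exact ⟨.b, by simp, by simp [wl], fun v => by
        first
          | exact (bcd_mul v).1.1
          | exact (bcd_mul v).1.2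
          | exact (bcd_mul v).2.1.1
          | exact (bcd_mul v).2.1.2
          | exact (bcd_mul v).2.2.1
          | exact (bcd_mul v).2.2.2⟩
    | exact ⟨.c, by simp, by simp [wl], fun v => by
        first
          | exact (bcd_mul v).1.1
          | exact (bcd_mul v).1.2
          | exact (bcd_mul v).2.1.1
          | exact (bcd_mul v).2.1.2
          | exact (bcd_mul v).2.2.1
          | exact (bcd_mul v).2.2.2⟩
    | exact ⟨.d, by simp, by simp [wl], fun v => by
        first
          | exact (bcd_mul v).1.1
          | exact (bcd_mul v).1.2
          | exact (bcd_mul v).2.1.1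
          | exact (bcd_mul v).2.1.2
          | exact (bcd_mul v).2.2.1
          | exact (bcd_mul v).2.2.2⟩

/-- Alternating words in `a` and the letters `b, c, d`. -/
inductive Alt : List Lt → Prop
  | nil : Alt []
  | single (x : Lt) : Alt [x]
  | consA (y : Lt) (t : List Lt) : y ≠ .a → Alt (y :: t) → Alt (.a :: y :: t)
  | consX (x : Lt) (t : List Lt) : x ≠ .a → Alt (.a :: t) → Alt (x :: .a :: t)

theorem Alt.tail {x : Lt} {t : List Lt} (h : Alt (x :: t)) : Alt t := by
  cases h with
  | single => exact .nil
  | consA y t _ h => exact h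
  | consX x t _ h => exact h

theorem Alt.replace {y z : Lt} {t : List Lt} (hy : y ≠ .a) (hz : z ≠ .a) (h : Alt (y :: t)) :
    Alt (z :: t) := by
  cases h with
  | single => exact .single _
  | consA y t _ h => exact absurd rfl hy
  | consX x t _ h => exact .consX _ _ hz h

theorem exists_alt (l : List Lt) : ∃ l', Alt l' ∧ wt l' ≤ wt l ∧ ∀ v, ev l' v = ev l v := by
  induction l with
  | nil => exact ⟨[], .nil, le_rfl, fun _ => rfl⟩
  | cons x t ih =>
    obtain ⟨t', ht, hw, he⟩ := ih
    cases t' with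
    | nil =>
      refine ⟨[x], .single x, by simp [wt], fun v => ?_⟩
      simp only [ev, ← he]
    | cons y s =>
      by_cases hxy : x = y
      · subst hxy
        refine ⟨s, ht.tail, ?_, fun v => ?_⟩
        · simp only [wt] at hw ⊢; omega
        · simp only [ev, ← he, act_act]
      · by_cases hx : x = .a
        · subst hx
          refine ⟨_, .consA y s (Ne.symm hxy) ht, ?_, fun v => ?_⟩
          · simp only [wt] at hw ⊢; omega
          · simp only [ev, ← he]
        · by_cases hy : y = .a
          · subst hy
            refine ⟨_, .consX x s hx ht, ?_, fun v => ?_⟩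
            · simp only [wt] at hw ⊢; omega
            · simp only [ev, ← he]
          · obtain ⟨z, hz, hzw, hze⟩ := act_mul x y hx hy hxy
            refine ⟨z :: s, ht.replace hy hz, ?_, fun v => ?_⟩
            · simp only [wt] at hw ⊢; omega
            · simp only [ev, ← he, hze]

/-- Section of a letter. -/
def secL : Lt → Bool → List Lt
  | .a, _ => []
  | .b, false => [.a]
  | .b, true => [.c]
  | .c, false => [.a]
  | .c, true => [.d]
  | .d, false => []
  | .d, true => [.b]

def flipL : Lt → Bool
  | .a => true
  | _ => false

theorem act_cons (x : Lt) (y : Bool) (v : List Bool) :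
    act x (y :: v) = (xor y (flipL x)) :: ev (secL x y) v := by
  cases x <;> cases y <;> simp [act, aFun, bFun, cFun, dFun, secL, ev, flipL]

def flipW : List Lt → Bool
  | [] => false
  | x :: t => xor (flipW t) (flipL x)

def secW : List Lt → Bool → List Lt
  | [], _ => []
  | x :: t, y => secL x (xor y (flipW t)) ++ secW t y

theorem ev_nil (l : List Lt) : ev l [] = [] := by
  induction l with
  | nil => rfl
  | cons x t ih => cases x <;> simp [ev, ih, act, aFun, bFun, cFun, dFun]

theorem ev_cons (l : List Lt) (y : Bool) (v : List Bool) :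
    ev l (y :: v) = (xor y (flipW l)) :: ev (secW l y) v := by
  induction l with
  | nil => simp [ev, flipW, secW]
  | cons x t ih => simp [ev, ih, act_cons, flipW, secW, ev_append]

def secwt (l : List Lt) : ℕ := wt (secW l false) + wt (secW l true)

theorem secwt_cons (x : Lt) (t : List Lt) :
    secwt (x :: t) = wt (secL x false) + wt (secL x true) + secwt t := by
  unfold secwt
  cases h : flipW t <;> simp [secW, h, wt_append] <;> omega

theorem secL_bound (x : Lt) (hx : x ≠ .a) :
    6 * (wt (secL x false) + wt (secL x true)) ≤ 15 + 5 * wl x := by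
  cases x <;> simp_all [secL, wt, wl]

theorem Alt.bound {l : List Lt} (h : Alt l) :
    6 * secwt l ≤ 5 * wt l + 15 ∧ (∀ t, l = .a :: t → 6 * secwt l ≤ 5 * wt l) := by
  induction h with
  | nil => simp [secwt, secW, wt]
  | single x => cases x <;> simp [secwt, secW, secL, wt, wl, flipW]
  | consA y t hy h ih =>
    have := secwt_cons .a (y :: t)
    have h1 := ih.1
    have h3 : 6 * secwt (.a :: y :: t) ≤ 5 * wt (.a :: y :: t) := by
      have h4 : wt (.a :: y :: t) = 3 + wt (y :: t) := rfl
      simp only [secL, wt.eq_1] at this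
      omega
    exact ⟨by omega, fun _ _ => h3⟩
  | consX x t hx h ih =>
    have h1 := secwt_cons x (.a :: t)
    have h2 := secL_bound x hx
    have h3 := ih.2 t rfl
    refine ⟨?_, fun s hs => absurd (List.cons.inj hs).1 hx⟩
    simp only [wt] at h3 ⊢
    omega

/-- Ball for the weighted length, as a set of functions. -/
def ball (n : ℕ) : Set (List Bool → List Bool) := {f | ∃ l, wt l ≤ n ∧ ev l = f}

theorem length_le_wt (l : List Lt) : l.length ≤ wt l := by
  induction l with
  | nil => simp
  | cons x t ih => cases x <;> simp [wt, wl] <;> omega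

theorem wt_le_length (l : List Lt) : wt l ≤ 3 * l.length := by
  induction l with
  | nil => simp [wt]
  | cons x t ih => cases x <;> simp [wt, wl] <;> omega

theorem ball_finite (n : ℕ) : (ball n).Finite := by
  refine ((List.finite_length_le Lt n).image ev).subset ?_
  rintro f ⟨l, hl, rfl⟩
  exact ⟨l, (length_le_wt l).trans hl, rfl⟩

noncomputable def ballF (n : ℕ) : Finset (List Bool → List Bool) := (ball_finite n).toFinset

theorem mem_ballF {n : ℕ} {f : List Bool → List Bool} :
    f ∈ ballF n ↔ ∃ l, wt l ≤ n ∧ ev l = f := by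
  simp [ballF, ball]

theorem ballF_mono {m n : ℕ} (h : m ≤ n) : ballF m ⊆ ballF n := by
  intro f hf
  obtain ⟨l, hl, rfl⟩ := mem_ballF.1 hf
  exact mem_ballF.2 ⟨l, hl.trans h, rfl⟩

def glue (e : Bool) (f g : List Bool → List Bool) : List Bool → List Bool
  | [] => []
  | false :: v => e :: f v
  | true :: v => (!e) :: g v

theorem ev_eq_glue (l : List Lt) :
    ev l = glue (flipW l) (ev (secW l false)) (ev (secW l true)) := by
  funext v
  rcases v with _ | ⟨_ | _, v⟩
  · simp [glue, ev_nil]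
  · simp [glue, ev_cons]
  · simp [glue, ev_cons]

open Classical in
theorem ballF_subset (n : ℕ) : ballF n ⊆
    (Finset.range (5 * (n + 3) / 6 + 1)).biUnion fun i =>
      (Finset.univ : Finset Bool).biUnion fun e =>
        Finset.image₂ (glue e) (ballF i) (ballF (5 * (n + 3) / 6 - i)) := by
  intro f hf
  obtain ⟨l, hl, rfl⟩ := mem_ballF.1 hf
  obtain ⟨l', ha, hw, he⟩ := exists_alt l
  have hb := ha.bound.1
  unfold secwt at hb
  simp only [Finset.mem_biUnion, Finset.mem_range, Finset.mem_univ, true_and, Finset.mem_image₂]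
  refine ⟨wt (secW l' false), by omega, flipW l', ev (secW l' false),
    mem_ballF.2 ⟨_, le_rfl, rfl⟩, ev (secW l' true), mem_ballF.2 ⟨_, by omega, rfl⟩, ?_⟩
  rw [← ev_eq_glue]
  exact funext he

theorem ballF_card (n : ℕ) : (ballF n).card ≤
    ∑ i ∈ Finset.range (5 * (n + 3) / 6 + 1),
      2 * ((ballF i).card * (ballF (5 * (n + 3) / 6 - i)).card) := by
  classical
  refine (Finset.card_le_card (ballF_subset n)).trans (Finset.card_biUnion_le.trans ?_)
  refine Finset.sum_le_sum fun i _ => Finset.card_biUnion_le.trans ?_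
  refine (Finset.sum_le_sum fun e _ => Finset.card_image₂_le _ _ _).trans ?_
  simp

theorem growth_le (n : ℕ) : grigGrowth n ≤ (ballF (3 * n)).card := by
  have hw : ∀ l : List (Equiv.Perm (List Bool)),
      (∀ x ∈ l, x ∈ ({a, b, c, d} : Set (Equiv.Perm (List Bool)))) →
      ∃ w : List Lt, w.length = l.length ∧ ∀ v, ev w v = l.prod v := by
    intro l hl
    induction l with
    | nil => exact ⟨[], rfl, fun v => rfl⟩
    | cons x t ih =>
      obtain ⟨w, hw, he⟩ := ih fun y hy => hl y (List.mem_cons_of_mem _ hy)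
      have hx : ∃ z : Lt, ∀ v, act z v = x v := by
        rcases hl x List.mem_cons_self with h | h | h | h
        · exact ⟨.a, fun v => by rw [h]; rfl⟩
        · exact ⟨.b, fun v => by rw [h]; rfl⟩
        · exact ⟨.c, fun v => by rw [h]; rfl⟩
        · exact ⟨.d, fun v => by rw [h]; rfl⟩
      obtain ⟨z, hz⟩ := hx
      exact ⟨z :: w, by simp [hw], fun v => by simp [ev, he, hz]⟩
  unfold grigGrowth
  rw [← Nat.card_eq_finsetCard]
  refine Nat.card_le_card_of_injective (fun g => ⟨⇑g.1, ?_⟩) ?_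
  · obtain ⟨l, hl, hm, hp⟩ := g.2
    obtain ⟨w, hwl, he⟩ := hw l hm
    refine mem_ballF.2 ⟨w, ?_, ?_⟩
    · have := wt_le_length w
      omega
    · rw [← hp]
      exact funext he
  · intro g g' h
    exact Subtype.ext (DFunLike.coe_injective (congrArg Subtype.val h))

/-- Numerical exponent inequality. -/
theorem kappa_lt : (2 : ℝ) * (3 / 7 : ℝ) ^ (9 / 10 : ℝ) < 1 := by
  have h0 : (0 : ℝ) ≤ (3 / 7 : ℝ) ^ (9 / 10 : ℝ) := by positivity
  have h : ((3 / 7 : ℝ) ^ (9 / 10 : ℝ)) ^ 10 = (3 / 7 : ℝ) ^ 9 := by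
    rw [← Real.rpow_natCast, ← Real.rpow_mul (by norm_num)]
    rw [← Real.rpow_natCast]; norm_num
  by_contra hc
  have h1 : (1 / 2 : ℝ) ≤ (3 / 7 : ℝ) ^ (9 / 10 : ℝ) := by linarith
  have h2 := pow_le_pow_left₀ (by norm_num) h1 10
  rw [h] at h2
  norm_num at h2

theorem concave_sum (x y : ℝ) (hx : 0 ≤ x) (hy : 0 ≤ y) :
    x ^ (9 / 10 : ℝ) + y ^ (9 / 10 : ℝ) ≤ 2 * ((x + y) / 2) ^ (9 / 10 : ℝ) := by
  have hc : ConcaveOn ℝ (Set.Ici 0) fun x : ℝ => x ^ (9 / 10 : ℝ) :=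
    Real.concaveOn_rpow (by norm_num) (by norm_num)
  have h := hc.2 (Set.mem_Ici.2 hx) (Set.mem_Ici.2 hy)
    (by norm_num : (0 : ℝ) ≤ 1 / 2) (by norm_num : (0 : ℝ) ≤ 1 / 2) (by norm_num)
  simp only [smul_eq_mul] at h
  have e : (1 / 2 : ℝ) * x + 1 / 2 * y = (x + y) / 2 := by ring
  rw [e] at h
  linarith

theorem eventually_lin (k : ℝ) (hk : 0 < k) :
    ∃ R : ℕ, ∀ n : ℕ, R ≤ n → 2 * ((n : ℝ) + 1) ≤ Real.exp (k * ((n : ℝ) + 1) ^ (9 / 10 : ℝ)) := by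
  have h1 := (isLittleO_log_rpow_atTop (r := 9 / 10) (by norm_num)).def (half_pos hk)
  have h2 := (tendsto_rpow_atTop (y := 9 / 10) (by norm_num)).eventually_ge_atTop
    (2 * Real.log 2 / k)
  have h3 := (h1.and (h2.and (Filter.eventually_ge_atTop 1)))
  have ht : Filter.Tendsto (fun n : ℕ => (n : ℝ) + 1) Filter.atTop Filter.atTop :=
    Filter.tendsto_atTop_add_const_right _ _ tendsto_natCast_atTop_atTop
  obtain ⟨R, hR⟩ := Filter.eventually_atTop.1 (ht.eventually h3)
  refine ⟨R, fun n hn => ?_⟩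
  obtain ⟨h1, h2, h3⟩ := hR n hn
  set x : ℝ := (n : ℝ) + 1
  have hx : 0 < x := by linarith
  rw [← Real.log_le_iff_le_exp (by positivity), Real.log_mul (by norm_num) hx.ne']
  have hp : (0 : ℝ) ≤ x ^ (9 / 10 : ℝ) := by positivity
  rw [Real.norm_of_nonneg (Real.log_nonneg h3), Real.norm_of_nonneg hp] at h1
  rw [div_le_iff₀ hk] at h2
  linarith

theorem ballF_bound : ∃ D : ℝ, 0 < D ∧
    ∀ n : ℕ, ((ballF n).card : ℝ) ≤ Real.exp (D * ((n : ℝ) + 1) ^ (9 / 10 : ℝ)) := by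
  set κ : ℝ := 2 * (3 / 7 : ℝ) ^ (9 / 10 : ℝ) with hκ
  have hκ1 : κ < 1 := kappa_lt
  obtain ⟨R, hR⟩ := eventually_lin (1 - κ) (by linarith)
  set R' := R + 200
  refine ⟨1 + (ballF R').card, by positivity, fun n => ?_⟩
  set D : ℝ := 1 + (ballF R').card with hD
  have hD1 : 1 ≤ D := by simp [hD]
  induction n using Nat.strong_induction_on with
  | _ n ih =>
  have hx1 : (1 : ℝ) ≤ ((n : ℝ) + 1) ^ (9 / 10 : ℝ) :=
    Real.one_le_rpow (by linarith [n.cast_nonneg (α := ℝ)]) (by norm_num)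
  by_cases hn : n < R'
  · have h1 : ((ballF n).card : ℝ) ≤ (ballF R').card := by
      exact_mod_cast Finset.card_le_card (ballF_mono hn.le)
    have h2 : D ≤ D * ((n : ℝ) + 1) ^ (9 / 10 : ℝ) := by nlinarith
    have h3 := Real.add_one_le_exp (D * ((n : ℝ) + 1) ^ (9 / 10 : ℝ))
    linarith
  · push Not at hn
    set m := 5 * (n + 3) / 6 with hm
    have hmn : m < n := by omega
    have hm7 : 7 * (m + 2) ≤ 6 * (n + 1) := by omega
    have hm7' : ((m : ℝ) + 2) / 2 ≤ 3 / 7 * ((n : ℝ) + 1) := by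
      have : (7 : ℝ) * (m + 2) ≤ 6 * (n + 1) := by exact_mod_cast hm7
      linarith
    have hc : ((ballF n).card : ℝ) ≤ ∑ i ∈ Finset.range (m + 1),
        2 * (((ballF i).card : ℝ) * (ballF (m - i)).card) := by
      exact_mod_cast ballF_card n
    have ht : ∀ i ∈ Finset.range (m + 1),
        2 * (((ballF i).card : ℝ) * (ballF (m - i)).card) ≤
          2 * Real.exp (D * (κ * ((n : ℝ) + 1) ^ (9 / 10 : ℝ))) := by
      intro i hi
      have him : i ≤ m := by simpa [Nat.lt_succ_iff] using hi
      have a1 := ih i (by omega)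
      have a2 := ih (m - i) (by omega)
      have a3 := mul_le_mul a1 a2 (by positivity) (by positivity)
      rw [← Real.exp_add, ← mul_add] at a3
      have a4 := concave_sum ((i : ℝ) + 1) (((m - i : ℕ) : ℝ) + 1) (by positivity) (by positivity)
      have a5 : ((i : ℝ) + 1 + (((m - i : ℕ) : ℝ) + 1)) / 2 = ((m : ℝ) + 2) / 2 := by
        rw [Nat.cast_sub him]; ring
      rw [a5] at a4
      have a6 : (((m : ℝ) + 2) / 2) ^ (9 / 10 : ℝ) ≤
          (3 / 7 : ℝ) ^ (9 / 10 : ℝ) * ((n : ℝ) + 1) ^ (9 / 10 : ℝ) := by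
        rw [← Real.mul_rpow (by norm_num) (by positivity)]
        exact Real.rpow_le_rpow (by positivity) hm7' (by norm_num)
      have a7 : ((i : ℝ) + 1) ^ (9 / 10 : ℝ) + (((m - i : ℕ) : ℝ) + 1) ^ (9 / 10 : ℝ) ≤
          κ * ((n : ℝ) + 1) ^ (9 / 10 : ℝ) := by
        rw [hκ]; linarith
      have a8 := Real.exp_le_exp.2 (mul_le_mul_of_nonneg_left a7 (by linarith : (0 : ℝ) ≤ D))
      linarith
    have hs := hc.trans (Finset.sum_le_sum ht)
    rw [Finset.sum_const, Finset.card_range, nsmul_eq_mul] at hs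
    have hr := hR n (by omega)
    have hmn' : ((m + 1 : ℕ) : ℝ) ≤ (n : ℝ) + 1 := by exact_mod_cast (by omega : m + 1 ≤ n + 1)
    set X := ((n : ℝ) + 1) ^ (9 / 10 : ℝ) with hX
    have hr2 : Real.exp ((1 - κ) * X) ≤ Real.exp (D * ((1 - κ) * X)) := by
      apply Real.exp_le_exp.2
      have : 0 ≤ (1 - κ) * X := mul_nonneg (by linarith) (by linarith)
      nlinarith
    have he : Real.exp (D * X) = Real.exp (D * ((1 - κ) * X)) * Real.exp (D * (κ * X)) := by
      rw [← Real.exp_add]; congr 1; ring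
    rw [he]
    calc ((ballF n).card : ℝ) ≤ ((m + 1 : ℕ) : ℝ) * (2 * Real.exp (D * (κ * X))) := hs
      _ ≤ ((n : ℝ) + 1) * (2 * Real.exp (D * (κ * X))) := by gcongr
      _ = (2 * ((n : ℝ) + 1)) * Real.exp (D * (κ * X)) := by ring
      _ ≤ _ := by
        gcongr
        exact hr.trans hr2

theorem growth_bound : ∃ C D : ℝ, 0 < C ∧ 0 < D ∧
      ∀ n : ℕ, (grigGrowth n : ℝ) ≤ C * Real.exp (D * (n : ℝ) ^ (9 / 10 : ℝ)) := by
  obtain ⟨D, hD, h⟩ := ballF_bound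
  refine ⟨Real.exp D, D * 3 ^ (9 / 10 : ℝ), Real.exp_pos _, by positivity, fun n => ?_⟩
  have h1 : (grigGrowth n : ℝ) ≤ (ballF (3 * n)).card := by exact_mod_cast growth_le n
  refine (h1.trans (h (3 * n))).trans ?_
  rw [← Real.exp_add]
  apply Real.exp_le_exp.2
  have h2 := Real.rpow_add_le_add_rpow (p := 9 / 10) (a := 3 * (n : ℝ)) (b := 1)
    (by positivity) (by norm_num) (by norm_num) (by norm_num)
  rw [Real.one_rpow, Real.mul_rpow (by norm_num) (by positivity)] at h2
  have h3 := mul_le_mul_of_nonneg_left h2 hD.le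
  push_cast
  linarith

/-- The Grigorchuk group has subexponential growth: `γ(n) ≤ C · exp (D n^ν)` for some
`0 < ν < 1` and `C, D > 0`; in particular `ln γ(n) / n → 0`. -/
theorem grigG_subexponential_growth :
    (∃ ν C D : ℝ, 0 < ν ∧ ν < 1 ∧ 0 < C ∧ 0 < D ∧
      ∀ n : ℕ, (grigGrowth n : ℝ) ≤ C * Real.exp (D * (n : ℝ) ^ ν)) ∧
    Filter.Tendsto (fun n : ℕ => Real.log (grigGrowth n) / n)
      Filter.atTop (nhds 0) := by
  obtain ⟨C, D, hC, hD, h⟩ := growth_bound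
  refine ⟨⟨9 / 10, C, D, by norm_num, by norm_num, hC, hD, h⟩, ?_⟩
  have hlog : ∀ n : ℕ, Real.log (grigGrowth n) ≤ |Real.log C| + D * (n : ℝ) ^ (9 / 10 : ℝ) := by
    intro n
    have hp : 0 ≤ D * (n : ℝ) ^ (9 / 10 : ℝ) := by positivity
    rcases Nat.eq_zero_or_pos (grigGrowth n) with h0 | h0
    · rw [h0]; simp only [Nat.cast_zero, Real.log_zero]; positivity
    · have h1 := Real.log_le_log (by exact_mod_cast h0) (h n)
      rw [Real.log_mul hC.ne' (Real.exp_pos _).ne', Real.log_exp] at h1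
      linarith [le_abs_self (Real.log C)]
  have t1 : Filter.Tendsto (fun n : ℕ => |Real.log C| / (n : ℝ)) Filter.atTop (nhds 0) :=
    tendsto_const_div_atTop_nhds_zero_nat _
  have t2 : Filter.Tendsto (fun n : ℕ => D * (n : ℝ) ^ (-(1 / 10 : ℝ))) Filter.atTop (nhds 0) := by
    have := ((tendsto_rpow_neg_atTop (y := 1 / 10) (by norm_num)).comp
      (tendsto_natCast_atTop_atTop (R := ℝ))).const_mul D
    simpa using this
  have t3 := t1.add t2
  rw [add_zero] at t3
  refine tendsto_of_tendsto_of_tendsto_of_le_of_le' tendsto_const_nhds t3 ?_ ?_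
  · exact Filter.Eventually.of_forall fun n =>
      div_nonneg (Real.log_natCast_nonneg _) n.cast_nonneg
  · filter_upwards [Filter.eventually_gt_atTop 0] with n hn
    have hn' : (0 : ℝ) < n := by exact_mod_cast hn
    have e : D * (n : ℝ) ^ (-(1 / 10 : ℝ)) = D * (n : ℝ) ^ (9 / 10 : ℝ) / n := by
      have : (-(1 / 10) : ℝ) = 9 / 10 - 1 := by norm_num
      rw [this, Real.rpow_sub_one hn'.ne', mul_div_assoc]
    rw [e, ← add_div]
    exact div_le_div_of_nonneg_right (hlog n) hn'.le

end Grig
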